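/- arXiv:math-ph/0105033 — 7 statements merged into one kernel-verified Lean document; each statement's English description precedes it below -/
import Mathlib

section
/- Fix n, l ∈ ℕ with n ≥ l. In P_n ⊗ P_l, the vector h = Σ_{k=0}^{l} (−1)^k · binom(l,k) · z₂^k z₁^{n−k} ⊗ z₁^k z₂^{l−k} satisfies (X₊⊗1 + 1⊗X₊)h = 0 and (X₃⊗1 + 1⊗X₃)h = ½(n−l)·h, where X₃ = ½(z₁∂₁ − z₂∂₂) and X₊ = z₁∂₂ act on homogeneous polynomials in z₁, z₂, and binom(l,k) denotes the binomial coefficient. -/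
open MvPolynomial

/-- Multiplication by the variable `zᵢ` ("creation operator" `aᵢ† = zᵢ`). -/
noncomputable def mulZ (i : Fin 2) : Module.End ℂ (MvPolynomial (Fin 2) ℂ) :=
  LinearMap.mulLeft ℂ (X i)

/-- The su(2) generators `X₁ = ½(z₁∂₂ + z₂∂₁)`, `X₂ = −(i/2)(z₁∂₂ − z₂∂₁)`,
`X₃ = ½(z₁∂₁ − z₂∂₂)` acting on `ℂ[z₁,z₂]` (variables indexed by `0, 1`,
operators indexed by `0, 1, 2`). -/
noncomputable def Xop : Fin 3 → Module.End ℂ (MvPolynomial (Fin 2) ℂ)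
  | 0 => ((1:ℂ)/2) • (mulZ 0 ∘ₗ (pderiv (R := ℂ) (1 : Fin 2)).toLinearMap
            + mulZ 1 ∘ₗ (pderiv (R := ℂ) (0 : Fin 2)).toLinearMap)
  | 1 => (-Complex.I/2) • (mulZ 0 ∘ₗ (pderiv (R := ℂ) (1 : Fin 2)).toLinearMap
            - mulZ 1 ∘ₗ (pderiv (R := ℂ) (0 : Fin 2)).toLinearMap)
  | 2 => ((1:ℂ)/2) • (mulZ 0 ∘ₗ (pderiv (R := ℂ) (0 : Fin 2)).toLinearMap
            - mulZ 1 ∘ₗ (pderiv (R := ℂ) (1 : Fin 2)).toLinearMap)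

/-- The totally antisymmetric Levi-Civita symbol `ε_{abc}` on `{0,1,2}` with `ε₀₁₂ = 1`. -/
noncomputable def eps (a b c : Fin 3) : ℂ :=
  (((b : ℤ) - (a : ℤ)) * ((c : ℤ) - (a : ℤ)) * ((c : ℤ) - (b : ℤ)) : ℂ) / 2


/-- The identity operator on `ℂ[z₁,z₂]`. -/
noncomputable def idP : Module.End ℂ (MvPolynomial (Fin 2) ℂ) := LinearMap.id

/-- `z₁∂₂` maps `z₁ᵃ z₂ᵇ` to `b z₁ᵃ⁺¹ z₂ᵇ⁻¹`. -/
theorem raising_monomial (a b : ℕ) :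
    (mulZ 0 ∘ₗ (pderiv (R := ℂ) (1 : Fin 2)).toLinearMap) (X 0 ^ a * X 1 ^ b)
      = (b : ℂ) • (X 0 ^ (a + 1) * X 1 ^ (b - 1)) := by
  simp [mulZ, Derivation.leibniz, Derivation.leibniz_pow, pderiv_X, smul_eq_C_mul]
  ring

/-- `z₁ᵃ z₂ᵇ` is a weight vector of `X₃` of weight `(a - b) / 2`. -/
theorem Xop_two_monomial (a b : ℕ) :
    Xop 2 (X 0 ^ a * X 1 ^ b) = (((a : ℂ) - b) / 2) • (X 0 ^ a * X 1 ^ b) := by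
  have h0 : (X 0 : MvPolynomial (Fin 2) ℂ) * pderiv 0 (X 0 ^ a * X 1 ^ b)
      = (a : ℂ) • (X 0 ^ a * X 1 ^ b) := by
    cases a <;>
      simp [Derivation.leibniz, Derivation.leibniz_pow, pderiv_X, smul_eq_C_mul]
    ring
  have h1 : (X 1 : MvPolynomial (Fin 2) ℂ) * pderiv 1 (X 0 ^ a * X 1 ^ b)
      = (b : ℂ) • (X 0 ^ a * X 1 ^ b) := by
    cases b <;>
      simp [Derivation.leibniz, Derivation.leibniz_pow, pderiv_X, smul_eq_C_mul]
    ring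
  change ((1 : ℂ) / 2) • ((X 0 : MvPolynomial (Fin 2) ℂ) * pderiv 0 (X 0 ^ a * X 1 ^ b)
    - X 1 * pderiv 1 (X 0 ^ a * X 1 ^ b)) = _
  rw [h0, h1, ← sub_smul, smul_smul]
  congr 1
  ring

open TensorProduct in
/-- In `P_n ⊗ P_l` (with `n ≥ l`), the vector
`h = Σ_{k=0}^{l} (−1)^k C(l,k) z₂^k z₁^{n−k} ⊗ z₁^k z₂^{l−k}` is annihilated by the total
raising operator `X₊⊗1 + 1⊗X₊` and is a weight vector of weight `(n−l)/2` for
`X₃⊗1 + 1⊗X₃`, where `X₃ = ½(z₁∂₁ − z₂∂₂)` and `X₊ = z₁∂₂`. -/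
theorem highest_weight_vector_bottom (n l : ℕ) (hnl : l ≤ n) :
    ∀ Xthree Xplus : Module.End ℂ (MvPolynomial (Fin 2) ℂ),
      Xthree = Xop 2 →
      Xplus = mulZ 0 ∘ₗ (pderiv (R := ℂ) (1 : Fin 2)).toLinearMap →
    ∀ h : MvPolynomial (Fin 2) ℂ ⊗[ℂ] MvPolynomial (Fin 2) ℂ,
      h = ∑ k ∈ Finset.range (l + 1),
            ((-1 : ℂ) ^ k * (Nat.choose l k : ℂ)) •
              ((X 1 ^ k * X 0 ^ (n - k)) ⊗ₜ[ℂ] (X 0 ^ k * X 1 ^ (l - k))) →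
      (TensorProduct.map Xplus idP + TensorProduct.map idP Xplus) h = 0 ∧
      (TensorProduct.map Xthree idP + TensorProduct.map idP Xthree) h
          = (((n : ℂ) - l) / 2) • h := by
  rintro _ _ rfl rfl h rfl
  constructor
  · have raise (k : ℕ) :
        (TensorProduct.map (mulZ 0 ∘ₗ (pderiv (R := ℂ) (1 : Fin 2)).toLinearMap) idP
          + TensorProduct.map idP (mulZ 0 ∘ₗ (pderiv (R := ℂ) (1 : Fin 2)).toLinearMap))
          ((X 1 ^ k * X 0 ^ (n - k)) ⊗ₜ[ℂ] (X 0 ^ k * X 1 ^ (l - k)))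
        = (k : ℂ) • ((X 0 ^ (n - k + 1) * X 1 ^ (k - 1)) ⊗ₜ[ℂ] (X 0 ^ k * X 1 ^ (l - k)))
          + ((l - k : ℕ) : ℂ) •
            ((X 0 ^ (n - k) * X 1 ^ k) ⊗ₜ[ℂ] (X 0 ^ (k + 1) * X 1 ^ (l - k - 1))) := by
      rw [mul_comm (X 1 ^ k), LinearMap.add_apply, TensorProduct.map_tmul,
        TensorProduct.map_tmul, raising_monomial, raising_monomial, ← TensorProduct.smul_tmul',
        TensorProduct.tmul_smul]
      rfl
    simp only [map_sum, map_smul, raise, smul_add, Finset.sum_add_distrib, smul_smul]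
    rw [Finset.sum_range_succ', Finset.sum_range_succ _ l]
    simp only [Nat.cast_zero, Nat.sub_self, mul_zero, zero_smul, add_zero]
    rw [← Finset.sum_add_distrib]
    refine Finset.sum_eq_zero fun k hk => ?_
    have hkl := Finset.mem_range.mp hk
    have hexp : n - (k + 1) + 1 = n - k := by omega
    have hcoeff : ((l.choose (k + 1) : ℕ) : ℂ) * ((k + 1 : ℕ) : ℂ)
        = (l.choose k : ℂ) * ((l - k : ℕ) : ℂ) := by
      exact_mod_cast Nat.choose_succ_right_eq l k
    rw [hexp, Nat.add_sub_cancel, Nat.sub_sub, ← add_smul, mul_assoc, mul_assoc, hcoeff,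
      pow_succ, mul_neg_one, neg_mul, neg_add_cancel, zero_smul]
  · rw [map_sum, Finset.smul_sum]
    refine Finset.sum_congr rfl fun k hk => ?_
    have hkl : k ≤ l := Nat.lt_succ_iff.mp (Finset.mem_range.mp hk)
    rw [map_smul, smul_comm, mul_comm (X 1 ^ k), LinearMap.add_apply, TensorProduct.map_tmul,
      TensorProduct.map_tmul, Xop_two_monomial, Xop_two_monomial, ← TensorProduct.smul_tmul',
      TensorProduct.tmul_smul]
    simp only [idP, LinearMap.id_apply]
    rw [← add_smul, Nat.cast_sub (hkl.trans hnl), Nat.cast_sub hkl]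
    congr 2
    ring
end

section
/- For all natural numbers n, l with n ≥ l, the identity Σ_{k=0}^{l} binom(l,k) / binom(n,k) = (n+1)/(n−l+1) holds, where binom(m,k) denotes the binomial coefficient. -/
/-- For `k ≤ l`, the ratio `C(l,k)/C(l+d,k)` equals `C(l-k+d,d)/C(l+d,d)`. -/
theorem choose_div_choose_add (l d k : ℕ) (hk : k ≤ l) :
    (Nat.choose l k : ℚ) / (Nat.choose (l + d) k : ℚ)
      = (Nat.choose (l - k + d) d : ℚ) / (Nat.choose (l + d) d : ℚ) := by
  have h₁ : ((l + d).choose k : ℚ) ≠ 0 :=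
    Nat.cast_ne_zero.mpr (Nat.choose_pos (by lia)).ne'
  have h₂ : ((l + d).choose d : ℚ) ≠ 0 :=
    Nat.cast_ne_zero.mpr (Nat.choose_pos (by lia)).ne'
  have h := Nat.choose_mul (n := l + d) (k := l) (s := k) hk
  rw [Nat.choose_symm_add, show l + d - k = l - k + d by lia, Nat.choose_symm_add] at h
  rw [div_eq_div_iff h₁ h₂]
  norm_cast
  linarith

/-- For `n ≥ l`, `Σ_{k=0}^{l} C(l,k)/C(n,k) = (n+1)/(n−l+1)`. -/
theorem binomial_sum_one (n l : ℕ) (hnl : l ≤ n) :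
    ∑ k ∈ Finset.range (l + 1), (Nat.choose l k : ℚ) / (Nat.choose n k : ℚ)
      = ((n : ℚ) + 1) / ((n : ℚ) - (l : ℚ) + 1) := by
  obtain ⟨d, rfl⟩ := Nat.exists_eq_add_of_le hnl
  have hchoose : ((l + d).choose d : ℚ) ≠ 0 :=
    Nat.cast_ne_zero.mpr (Nat.choose_pos (by lia)).ne'
  have hsum : ∑ k ∈ Finset.range (l + 1), (l - k + d).choose d
      = (l + d + 1).choose (d + 1) := by
    rw [← Nat.sum_range_add_choose l d,
      ← Finset.sum_range_reflect (fun i => (i + d).choose d) (l + 1)]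
    simp
  rw [Finset.sum_congr rfl fun k hk =>
      choose_div_choose_add l d k (Nat.lt_succ_iff.mp (Finset.mem_range.mp hk)),
    ← Finset.sum_div, ← Nat.cast_sum, hsum,
    show ((l + d : ℕ) : ℚ) - l + 1 = d + 1 by push_cast; ring,
    div_eq_div_iff hchoose (by positivity)]
  exact_mod_cast (Nat.add_one_mul_choose_eq (l + d) d).symm
end

section
/- For all natural numbers n, l with n > l, the identity Σ_{k=0}^{l} binom(l,k) / binom(n,k+1) = (n+1)/((n−l)(n+1−l)) holds, where binom(m,k) denotes the binomial coefficient. -/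
/-- The binomial recurrence in the lower index, as a formula for `C(m,k+1)` over `ℚ`. -/
theorem cast_choose_succ_eq_mul_div {m k : ℕ} (hk : k ≤ m) :
    (m.choose (k + 1) : ℚ) = m.choose k * ((m : ℚ) - k) / ((k : ℚ) + 1) := by
  rw [eq_div_iff (by positivity)]
  have h := Nat.choose_succ_right_eq m k
  rw [← Nat.cast_sub hk]
  exact_mod_cast h

/-- An antidifference in `k` of the hypergeometric term `C(l,k)/C(n,k+1)`. -/
theorem choose_div_choose_succ_eq_sub {n l k : ℕ} (hnl : l < n) (hk : k ≤ l) :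
    (l.choose k : ℚ) / n.choose (k + 1)
      = ((k : ℚ) * ((n : ℚ) - l) + n + 1) / (((n : ℚ) - l) * ((n : ℚ) + 1 - l))
          * (l.choose k / n.choose k)
        - (((k + 1 : ℕ) : ℚ) * ((n : ℚ) - l) + n + 1) / (((n : ℚ) - l) * ((n : ℚ) + 1 - l))
          * (l.choose (k + 1) / n.choose (k + 1)) := by
  rw [cast_choose_succ_eq_mul_div hk, cast_choose_succ_eq_mul_div (hk.trans hnl.le)]
  have hln : (l : ℚ) < n := by exact_mod_cast hnl
  have hkl : (k : ℚ) ≤ l := by exact_mod_cast hk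
  have hc : (n.choose k : ℚ) ≠ 0 := by
    exact_mod_cast (Nat.choose_pos (hk.trans hnl.le)).ne'
  have hnk : (n : ℚ) - k ≠ 0 := by linarith
  have hd : (n : ℚ) - l ≠ 0 := by linarith
  have hd' : (n : ℚ) + 1 - l ≠ 0 := by linarith
  have hk' : (k : ℚ) + 1 ≠ 0 := by positivity
  push_cast
  field_simp
  ring

/-- For `n > l`, `Σ_{k=0}^{l} C(l,k)/C(n,k+1) = (n+1)/((n−l)(n+1−l))`. -/
theorem binomial_sum_two (n l : ℕ) (hnl : l < n) :
    ∑ k ∈ Finset.range (l + 1), (Nat.choose l k : ℚ) / (Nat.choose n (k + 1) : ℚ)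
      = ((n : ℚ) + 1) / (((n : ℚ) - (l : ℚ)) * ((n : ℚ) + 1 - (l : ℚ))) := by
  rw [Finset.sum_congr rfl fun k hk =>
    choose_div_choose_succ_eq_sub hnl (Finset.mem_range_succ_iff.mp hk)]
  rw [Finset.sum_range_sub' fun k : ℕ =>
    ((k : ℚ) * ((n : ℚ) - l) + n + 1) / (((n : ℚ) - l) * ((n : ℚ) + 1 - l))
      * ((l.choose k : ℚ) / n.choose k)]
  simp
end

section
/- For all natural numbers n, l with n > l, the identity Σ_{k=0}^{l} (n−k) · binom(l,k) / binom(n,k+1) = (n+1)(n+2)/((n+1−l)(n+2−l)) holds, where binom(m,k) denotes the binomial coefficient. -/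
/-- The cast to `ℚ` of the absorption identity `Nat.choose_succ_right_eq`. -/
theorem cast_choose_succ_mul_succ {n k : ℕ} (h : k ≤ n) :
    (n.choose (k + 1) : ℚ) * (k + 1) = n.choose k * (n - k) := by
  have := Nat.choose_succ_right_eq n k
  rw [← Nat.cast_sub h]
  exact_mod_cast this

/-- Closed form of the partial sums of `(n - k) * C(l, k) / C(n, k + 1)`. -/
theorem partial_sum_choose_div_choose {n l : ℕ} (hnl : l < n) {m : ℕ} (hm : m ≤ l + 1) :
    ∑ k ∈ Finset.range m, ((n : ℚ) - k) * l.choose k / n.choose (k + 1)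
      = (((n : ℚ) + 1) * (n + 2)
          - ((n + 1 - l) * m + n + 2) * (n + 1 - m) * (l.choose m / n.choose m))
        / ((n + 1 - l) * (n + 2 - l)) := by
  have hln : (l : ℚ) < n := by exact_mod_cast hnl
  have h₁ : (n : ℚ) + 1 - l ≠ 0 := by linarith
  have h₂ : (n : ℚ) + 2 - l ≠ 0 := by linarith
  induction m with
  | zero =>
    simp only [Finset.range_zero, Finset.sum_empty, Nat.choose_zero_right]
    push_cast
    ring
  | succ k ih =>
    rw [Finset.sum_range_succ, ih (by omega)]
    have hk : (k : ℚ) + 1 ≠ 0 := by positivity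
    have hnk : (n : ℚ) - k ≠ 0 := by
      have : (k : ℚ) < n := by exact_mod_cast (by omega : k < n)
      linarith
    have hc : (n.choose k : ℚ) ≠ 0 := by
      exact_mod_cast (Nat.choose_pos (by omega : k ≤ n)).ne'
    have hn : (n.choose (k + 1) : ℚ) = n.choose k * (n - k) / (k + 1) :=
      eq_div_of_mul_eq hk (cast_choose_succ_mul_succ (by omega))
    have hl : (l.choose (k + 1) : ℚ) = l.choose k * (l - k) / (k + 1) :=
      eq_div_of_mul_eq hk (cast_choose_succ_mul_succ (by omega))
    rw [hn, hl]
    push_cast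
    field_simp
    ring


/-- For `n > l`, `Σ_{k=0}^{l} (n−k)·C(l,k)/C(n,k+1) = (n+1)(n+2)/((n+1−l)(n+2−l))`
(equation (22) of the paper). -/
theorem binomial_sum_three (n l : ℕ) (hnl : l < n) :
    ∑ k ∈ Finset.range (l + 1),
        ((n : ℚ) - (k : ℚ)) * (Nat.choose l k : ℚ) / (Nat.choose n (k + 1) : ℚ)
      = ((n : ℚ) + 1) * ((n : ℚ) + 2) / ((((n : ℚ) + 1 - (l : ℚ)) * ((n : ℚ) + 2 - (l : ℚ)))) := by
  rw [partial_sum_choose_div_choose hnl le_rfl, Nat.choose_succ_self]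
  simp
end

section
/- For all natural numbers n, l with n > l, the identity Σ_{k=0}^{l} (n−2k−2) · binom(l,k) / binom(n,k+1) = (n+1)(n+2)(n−l−2)/((n−l)(n−l+1)(n−l+2)) holds as an identity of rational numbers, where binom(m,k) denotes the binomial coefficient. -/
/-- The absorption identity `(k+1)·C(n,k+1) = (n−k)·C(n,k)`, with the subtraction in `ℚ`. -/
theorem cast_choose_succ_mul (n k : ℕ) :
    (Nat.choose n (k + 1) : ℚ) * ((k : ℚ) + 1) = (Nat.choose n k : ℚ) * ((n : ℚ) - k) := by
  rcases le_or_gt k n with h | h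
  · have := Nat.choose_succ_right_eq n k
    rw [← Nat.cast_sub h]
    exact_mod_cast this
  · simp [Nat.choose_eq_zero_of_lt h, Nat.choose_eq_zero_of_lt (h.trans k.lt_succ_self)]

/-- If `q` solves the first-order recurrence
`(l−k)·q(k+1) − (n−k)·q(k) = (k+1)·p(k)`, then `Σ_{k=0}^{l} p(k)·C(l,k)/C(n,k+1)` telescopes. -/
theorem sum_mul_choose_div_choose_succ {n l : ℕ} (hnl : l < n) (p q : ℕ → ℚ)
    (hq : ∀ k : ℕ, ((l : ℚ) - k) * q (k + 1) - ((n : ℚ) - k) * q k = ((k : ℚ) + 1) * p k) :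
    ∑ k ∈ Finset.range (l + 1), p k * (Nat.choose l k : ℚ) / (Nat.choose n (k + 1) : ℚ)
      = -q 0 := by
  have step : ∀ k ∈ Finset.range (l + 1),
      p k * (Nat.choose l k : ℚ) / (Nat.choose n (k + 1) : ℚ)
        = q (k + 1) * (Nat.choose l (k + 1) : ℚ) / (Nat.choose n (k + 1) : ℚ)
          - q k * (Nat.choose l k : ℚ) / (Nat.choose n k : ℚ) := by
    intro k hk
    have hkl : k < l + 1 := Finset.mem_range.mp hk
    have hn₀ : (Nat.choose n k : ℚ) ≠ 0 :=
      Nat.cast_ne_zero.mpr (Nat.choose_pos (by omega)).ne'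
    have hn₁ : (Nat.choose n (k + 1) : ℚ) ≠ 0 :=
      Nat.cast_ne_zero.mpr (Nat.choose_pos (by omega)).ne'
    have hk₁ : (k : ℚ) + 1 ≠ 0 := by positivity
    have hl := cast_choose_succ_mul l k
    have hn := cast_choose_succ_mul n k
    rw [div_sub_div _ _ hn₁ hn₀, div_eq_div_iff hn₁ (mul_ne_zero hn₁ hn₀)]
    apply mul_left_cancel₀ hk₁
    linear_combination
      (-(Nat.choose l k : ℚ) * Nat.choose n (k + 1) * Nat.choose n k) * hq k
        - q (k + 1) * Nat.choose n k * Nat.choose n (k + 1) * hl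
        + q k * Nat.choose l k * Nat.choose n (k + 1) * hn
  rw [Finset.sum_congr rfl step,
    Finset.sum_range_sub fun k => q k * (Nat.choose l k : ℚ) / (Nat.choose n k : ℚ)]
  simp


/-- For `n > l`,
`Σ_{k=0}^{l} (n−2k−2)·C(l,k)/C(n,k+1) = (n+1)(n+2)(n−l−2)/((n−l)(n−l+1)(n−l+2))`. -/
theorem binomial_sum_four (n l : ℕ) (hnl : l < n) :
    ∑ k ∈ Finset.range (l + 1),
        ((n : ℚ) - 2 * (k : ℚ) - 2) * (Nat.choose l k : ℚ) / (Nat.choose n (k + 1) : ℚ)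
      = ((n : ℚ) + 1) * ((n : ℚ) + 2) * ((n : ℚ) - (l : ℚ) - 2) /
          ((((n : ℚ) - (l : ℚ)) * ((n : ℚ) - (l : ℚ) + 1) * ((n : ℚ) - (l : ℚ) + 2))) := by
  have hpos : (0 : ℚ) < (n : ℚ) - l := sub_pos.mpr (Nat.cast_lt.mpr hnl)
  have h₀ : (n : ℚ) - l ≠ 0 := hpos.ne'
  have h₁ : (n : ℚ) - l + 1 ≠ 0 := by positivity
  have h₂ : (n : ℚ) - l + 2 ≠ 0 := by positivity
  obtain ⟨a, ha⟩ : ∃ a : ℚ, a * ((n : ℚ) - l + 2) = 2 := ⟨_, div_mul_cancel₀ _ h₂⟩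
  obtain ⟨b, hb⟩ : ∃ b : ℚ, b * ((n : ℚ) - l + 1) = a * (2 * l - 1) - n + 4 :=
    ⟨_, div_mul_cancel₀ _ h₁⟩
  obtain ⟨c, hc⟩ : ∃ c : ℚ, c * ((n : ℚ) - l) = l * (a + b) - n + 2 := ⟨_, div_mul_cancel₀ _ h₀⟩
  rw [sum_mul_choose_div_choose_succ hnl (fun k => (n : ℚ) - 2 * k - 2)
    (fun k => a * (k : ℚ) ^ 2 + b * k + c)]
  · rw [eq_div_iff (by positivity)]
    push_cast
    linear_combination (-((n : ℚ) - l + 1) * (n - l + 2)) * hc - l * ((n : ℚ) - l + 2) * hb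
      - l * ((n : ℚ) + l) * ha
  · intro k
    push_cast
    linear_combination -(k : ℚ) ^ 2 * ha - k * hb - hc
end

section
/- Fix n, l ∈ ℕ with n ≥ 1 and l ≥ 1. Equip ℂ[z₁,z₂] with the hermitian inner product determined by declaring distinct monomials orthogonal and ⟨z₁^a z₂^b, z₁^a z₂^b⟩ = a!·b!, and equip P_n ⊗ P_l with the induced product inner product. Let h = z₁ⁿ ⊗ z₁ˡ, let w = (X₁⊗1)h where X₁ = ½(z₁∂₂ + z₂∂₁), and let v = (X₋⊗1 + 1⊗X₋)h where X₋ = z₂∂₁. Then ⟨v, w⟩ / ⟨v, v⟩ = n / (2(n+l)). -/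
open MvPolynomial

open TensorProduct

/-- The Bargmann hermitian inner product on a polynomial ring over `ℂ`: distinct monomials
are orthogonal and `⟨∏ zᵢ^{aᵢ}, ∏ zᵢ^{aᵢ}⟩ = ∏ aᵢ!` (conjugate-linear in the first
argument). -/
noncomputable def binner {σ : Type*} (p q : MvPolynomial σ ℂ) : ℂ :=
  ∑ m ∈ p.support,
    (starRingEnd ℂ) (p.coeff m) * q.coeff m * (m.prod fun _ k => (k.factorial : ℂ))

/-- The canonical identification of `ℂ[z₁,z₂] ⊗ ℂ[z₁,z₂]` with the polynomial ring in two
pairs of variables, sending `p ⊗ q` to `p(z_left)·q(z_right)`. -/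
noncomputable def phi :
    (MvPolynomial (Fin 2) ℂ ⊗[ℂ] MvPolynomial (Fin 2) ℂ) →ₐ[ℂ] MvPolynomial (Fin 2 ⊕ Fin 2) ℂ :=
  Algebra.TensorProduct.productMap (rename Sum.inl) (rename Sum.inr)

/-- The induced product inner product on `ℂ[z₁,z₂] ⊗ ℂ[z₁,z₂]`: on pure tensors,
`⟨p₁ ⊗ p₂, q₁ ⊗ q₂⟩ = ⟨p₁,q₁⟩·⟨p₂,q₂⟩` for the Bargmann inner products of the factors. -/
noncomputable def tinner (x y : MvPolynomial (Fin 2) ℂ ⊗[ℂ] MvPolynomial (Fin 2) ℂ) : ℂ :=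
  binner (phi x) (phi y)

theorem binner_eq_sum_of_support_subset {σ : Type*} {p : MvPolynomial σ ℂ}
    {s : Finset (σ →₀ ℕ)} (hs : p.support ⊆ s) (q : MvPolynomial σ ℂ) :
    binner p q = ∑ m ∈ s,
      (starRingEnd ℂ) (p.coeff m) * q.coeff m * (m.prod fun _ k => (k.factorial : ℂ)) := by
  refine Finset.sum_subset hs fun m _ hm => ?_
  simp [notMem_support_iff.mp hm]

theorem binner_add_left {σ : Type*} (p₁ p₂ q : MvPolynomial σ ℂ) :
    binner (p₁ + p₂) q = binner p₁ q + binner p₂ q := by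
  classical
  rw [binner_eq_sum_of_support_subset support_add q,
    binner_eq_sum_of_support_subset Finset.subset_union_left q,
    binner_eq_sum_of_support_subset Finset.subset_union_right q, ← Finset.sum_add_distrib]
  refine Finset.sum_congr rfl fun m _ => ?_
  rw [coeff_add, map_add]
  ring

theorem binner_monomial_left {σ : Type*} (m : σ →₀ ℕ) (c : ℂ) (q : MvPolynomial σ ℂ) :
    binner (monomial m c) q =
      (starRingEnd ℂ) c * q.coeff m * (m.prod fun _ k => (k.factorial : ℂ)) := by
  classical
  rw [binner_eq_sum_of_support_subset support_monomial_subset, Finset.sum_singleton,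
    coeff_monomial, if_pos rfl]

/-- The exponent of `z₁ᵃ z₂ᵇ ⊗ z₁ᶜ z₂ᵈ` in the two pairs of variables. -/
noncomputable def pairExponent (a b c d : ℕ) : Fin 2 ⊕ Fin 2 →₀ ℕ :=
  Finsupp.equivFunOnFinite.symm (Sum.elim ![a, b] ![c, d])

theorem pairExponent_prod_factorial (a b c d : ℕ) :
    ((pairExponent a b c d).prod fun _ k => (k.factorial : ℂ)) =
      a.factorial * b.factorial * (c.factorial * d.factorial) := by
  rw [Finsupp.prod_fintype _ _ (by simp)]
  simp [pairExponent, Fintype.prod_sum_type, Fin.prod_univ_two]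

theorem pairExponent_injective_snd {a b c d a' b' c' d' : ℕ}
    (h : pairExponent a b c d = pairExponent a' b' c' d') : b = b' := by
  simpa [pairExponent] using DFunLike.congr_fun h (Sum.inl 1)

theorem phi_tmul_eq_monomial (a b c d : ℕ) :
    phi ((X 0 ^ a * X 1 ^ b) ⊗ₜ[ℂ] (X 0 ^ c * X 1 ^ d)) =
      monomial (pairExponent a b c d) 1 := by
  rw [monomial_eq, Finsupp.prod_fintype _ _ (by simp)]
  simp [phi, pairExponent, Fintype.prod_sum_type, Fin.prod_univ_two]

/-- For `h = z₁ⁿ ⊗ z₁ˡ`, `w = (X₁⊗1)h` and `v = (X₋⊗1 + 1⊗X₋)h` with `X₋ = z₂∂₁`, one has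
`⟨v,w⟩/⟨v,v⟩ = n/(2(n+l))` — the proportionality factor `λ` for the projection onto the
highest spin subrepresentation. -/
theorem lambda_top (n l : ℕ) (hn : 1 ≤ n) (hl : 1 ≤ l) :
    ∀ Xone Xminus : Module.End ℂ (MvPolynomial (Fin 2) ℂ),
      Xone = Xop 0 →
      Xminus = mulZ 1 ∘ₗ (pderiv (R := ℂ) (0 : Fin 2)).toLinearMap →
    ∀ h w v : MvPolynomial (Fin 2) ℂ ⊗[ℂ] MvPolynomial (Fin 2) ℂ,
      h = (X 0 ^ n) ⊗ₜ[ℂ] (X 0 ^ l) →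
      w = TensorProduct.map Xone idP h →
      v = (TensorProduct.map Xminus idP + TensorProduct.map idP Xminus) h →
      tinner v w / tinner v v = (n : ℂ) / (2 * ((n : ℂ) + (l : ℂ))) := by
  rintro _ _ rfl rfl _ w v rfl hw hv
  obtain ⟨n, rfl⟩ := Nat.exists_eq_add_of_le' hn
  obtain ⟨l, rfl⟩ := Nat.exists_eq_add_of_le' hl
  have lower (k : ℕ) : mulZ 1 (pderiv (R := ℂ) (0 : Fin 2) (X 0 ^ (k + 1))) =
      ((k : ℂ) + 1) • (X 0 ^ k * X 1 ^ 1) := by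
    simp [mulZ, smul_eq_C_mul]
    ring
  have raise (k : ℕ) : mulZ 0 (pderiv (R := ℂ) (1 : Fin 2) (X 0 ^ (k + 1))) = 0 := by
    simp
  have unit (k : ℕ) : idP (X 0 ^ k) = X 0 ^ k * X 1 ^ 0 := by simp [idP]
  have phi_w : phi w = monomial (pairExponent n 1 (l + 1) 0) (((n : ℂ) + 1) / 2) := by
    rw [hw, TensorProduct.map_tmul, unit]
    simp only [Xop, LinearMap.smul_apply, LinearMap.add_apply, LinearMap.comp_apply,
      Derivation.coeFn_coe, lower, raise, zero_add, smul_smul,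
      ← TensorProduct.smul_tmul', map_smul, phi_tmul_eq_monomial, smul_monomial, smul_eq_mul]
    congr 1
    ring
  have phi_v : phi v = monomial (pairExponent n 1 (l + 1) 0) ((n : ℂ) + 1) +
      monomial (pairExponent (n + 1) 0 l 1) ((l : ℂ) + 1) := by
    rw [hv, LinearMap.add_apply, TensorProduct.map_tmul, TensorProduct.map_tmul, unit, unit]
    simp only [LinearMap.comp_apply, Derivation.coeFn_coe, lower,
      TensorProduct.tmul_smul, ← TensorProduct.smul_tmul', map_add, map_smul,
      phi_tmul_eq_monomial, smul_monomial, smul_eq_mul, mul_one]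
  have hne : pairExponent n 1 (l + 1) 0 ≠ pairExponent (n + 1) 0 l 1 :=
    fun h => one_ne_zero (pairExponent_injective_snd h)
  have hn0 : (n.factorial : ℂ) ≠ 0 := by exact_mod_cast n.factorial_ne_zero
  have hl0 : (l.factorial : ℂ) ≠ 0 := by exact_mod_cast l.factorial_ne_zero
  have hn1 : (n : ℂ) + 1 ≠ 0 := by exact_mod_cast n.succ_ne_zero
  have hl1 : (l : ℂ) + 1 ≠ 0 := by exact_mod_cast l.succ_ne_zero
  have hnl : (n : ℂ) + 1 + (l + 1) ≠ 0 := by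
    exact_mod_cast (by lia : n + 1 + (l + 1) ≠ 0)
  have inner_vw : tinner v w =
      (n + 1) * ((n + 1) / 2) * (n.factorial * ((l + 1) * l.factorial)) := by
    simp [tinner, phi_v, phi_w, binner_add_left, binner_monomial_left, coeff_monomial, hne,
      pairExponent_prod_factorial, Nat.factorial_succ]
    ring
  have inner_vv : tinner v v =
      (n + 1) * (l + 1) * (n.factorial * l.factorial) * (n + 1 + (l + 1)) := by
    simp [tinner, phi_v, binner_add_left, binner_monomial_left, coeff_monomial, hne, hne.symm,
      pairExponent_prod_factorial, Nat.factorial_succ]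
    ring
  rw [inner_vw, inner_vv]
  push_cast
  field_simp
end

section
/- Fix n ∈ ℕ and let P_n be the space of homogeneous polynomials of degree n in z₁, z₂, carrying the operators X₁ = ½(z₁∂₂ + z₂∂₁), X₂ = −(i/2)(z₁∂₂ − z₂∂₁), X₃ = ½(z₁∂₁ − z₂∂₂). Suppose F : {1,2,3} × {1,2,3} → End(P_n) is antisymmetric, F(a,b) = −F(b,a), and equivariant in the sense that for all a, b, c ∈ {1,2,3}: [X_a, F(b,c)] = i·Σ_d ( ε_{abd} F(d,c) + ε_{acd} F(b,d) ). Then there exists a scalar f ∈ ℂ such that F(a,b) = f · Σ_c ε_{abc} X_c for all a, b. -/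
open MvPolynomial

/-- The raising operator `z₁∂₂`. -/
noncomputable def raiseOp : Module.End ℂ (MvPolynomial (Fin 2) ℂ) :=
  mulZ 0 ∘ₗ (pderiv (R := ℂ) (1 : Fin 2)).toLinearMap

/-- The lowering operator `z₂∂₁`. -/
noncomputable def lowerOp : Module.End ℂ (MvPolynomial (Fin 2) ℂ) :=
  mulZ 1 ∘ₗ (pderiv (R := ℂ) (0 : Fin 2)).toLinearMap

/-- The weight operator `z₁∂₁ - z₂∂₂`. -/
noncomputable def weightOp : Module.End ℂ (MvPolynomial (Fin 2) ℂ) :=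
  mulZ 0 ∘ₗ (pderiv (R := ℂ) (0 : Fin 2)).toLinearMap
    - mulZ 1 ∘ₗ (pderiv (R := ℂ) (1 : Fin 2)).toLinearMap

lemma raiseOp_apply (p : MvPolynomial (Fin 2) ℂ) : raiseOp p = X 0 * pderiv 1 p := rfl

lemma lowerOp_apply (p : MvPolynomial (Fin 2) ℂ) : lowerOp p = X 1 * pderiv 0 p := rfl

lemma weightOp_apply (p : MvPolynomial (Fin 2) ℂ) :
    weightOp p = X 0 * pderiv 0 p - X 1 * pderiv 1 p := rfl

lemma Xop_zero : Xop 0 = ((1:ℂ)/2) • (raiseOp + lowerOp) := rfl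

lemma Xop_one : Xop 1 = (-Complex.I/2) • (raiseOp - lowerOp) := rfl

lemma Xop_two : Xop 2 = ((1:ℂ)/2) • weightOp := rfl

lemma X_mul_pderiv_mem (i j : Fin 2) {n : ℕ} {p : MvPolynomial (Fin 2) ℂ}
    (hp : p ∈ homogeneousSubmodule (Fin 2) ℂ n) :
    X i * pderiv j p ∈ homogeneousSubmodule (Fin 2) ℂ n := by
  rw [mem_homogeneousSubmodule] at hp ⊢
  rcases n with _ | n
  · rw [totalDegree_eq_zero_iff_eq_C.1 (Nat.le_zero.1 hp.totalDegree_le), pderiv_C, mul_zero]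
    exact isHomogeneous_zero _ _ _
  · have := (isHomogeneous_X ℂ i).mul (hp.pderiv (i := j))
    rwa [Nat.add_sub_cancel, add_comm] at this

lemma pderiv_zero_pderiv_one (p : MvPolynomial (Fin 2) ℂ) :
    pderiv 0 (pderiv 1 p) = pderiv 1 (pderiv 0 p) := by
  have h : ⁅pderiv (R := ℂ) (0 : Fin 2), pderiv (1 : Fin 2)⁆ = 0 :=
    derivation_ext fun i ↦ by
      rw [Derivation.commutator_apply]
      fin_cases i <;> simp
  have hp := congr($h p)
  rwa [Derivation.commutator_apply, Derivation.zero_apply, sub_eq_zero] at hp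

lemma lowerOp_raiseOp_sub (p : MvPolynomial (Fin 2) ℂ) :
    lowerOp (raiseOp p) - raiseOp (lowerOp p) = -weightOp p := by
  simp only [lowerOp_apply, raiseOp_apply, weightOp_apply, Derivation.leibniz, pderiv_X,
    pderiv_zero_pderiv_one,
    smul_eq_mul]
  simp
  ring

lemma lowerOp_weightOp_sub (p : MvPolynomial (Fin 2) ℂ) :
    lowerOp (weightOp p) - weightOp (lowerOp p) = (2:ℂ) • lowerOp p := by
  simp only [lowerOp_apply, weightOp_apply, Derivation.leibniz, pderiv_X,
    pderiv_zero_pderiv_one, map_sub,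
    smul_eq_mul, two_smul]
  simp
  ring

lemma coeff_weightOp (d : Fin 2 →₀ ℕ) (p : MvPolynomial (Fin 2) ℂ) :
    coeff d (weightOp p) = ((d 0 : ℂ) - d 1) * coeff d p := by
  induction p using MvPolynomial.induction_on' with
  | monomial m r =>
    rw [weightOp_apply, X_mul_pderiv_monomial, X_mul_pderiv_monomial]
    simp only [coeff_sub, coeff_smul, coeff_monomial]
    split_ifs with h
    · subst h; simp; ring
    · simp
  | add p q hp hq => simp [hp, hq, mul_add]

lemma X_pow_mul_X_pow_eq (i j : ℕ) : (X 0 ^ i * X 1 ^ j : MvPolynomial (Fin 2) ℂ) =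
    monomial (Finsupp.single 0 i + Finsupp.single 1 j) 1 := by
  simp [X_pow_eq_monomial, monomial_mul]

lemma weightOp_X_pow_mul (i j : ℕ) :
    weightOp (X 0 ^ i * X 1 ^ j) = ((i : ℂ) - j) • (X 0 ^ i * X 1 ^ j) := by
  rw [weightOp_apply, X_pow_mul_X_pow_eq, X_mul_pderiv_monomial, X_mul_pderiv_monomial, sub_smul]
  simp [Nat.cast_smul_eq_nsmul]

lemma raiseOp_X_pow (i : ℕ) : raiseOp (X 0 ^ i) = 0 := by
  simp [raiseOp_apply]

lemma raiseOp_X_pow_mul_succ (i j : ℕ) :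
    raiseOp (X 0 ^ i * X 1 ^ (j + 1)) = ((j : ℂ) + 1) • (X 0 ^ (i + 1) * X 1 ^ j) := by
  simp [raiseOp_apply, Derivation.leibniz, smul_eq_C_mul]
  ring

lemma degree_eq_and_weight_eq {n : ℕ} {q : MvPolynomial (Fin 2) ℂ} {μ : ℤ}
    (hq : q ∈ homogeneousSubmodule (Fin 2) ℂ n) (hw : weightOp q = (μ : ℂ) • q)
    {d : Fin 2 →₀ ℕ} (hd : coeff d q ≠ 0) : d 0 + d 1 = n ∧ (d 0 : ℤ) - d 1 = μ := by
  constructor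
  · rw [← hq hd]
    simp [Finsupp.weight_apply, Finsupp.sum_fintype]
  · have h := congr(coeff d $hw)
    rw [coeff_weightOp, coeff_smul, smul_eq_mul] at h
    exact_mod_cast mul_right_cancel₀ hd h

lemma eq_zero_of_weight_gt {n : ℕ} {q : MvPolynomial (Fin 2) ℂ} {μ : ℤ}
    (hq : q ∈ homogeneousSubmodule (Fin 2) ℂ n) (hw : weightOp q = (μ : ℂ) • q)
    (hμ : (n : ℤ) < μ) : q = 0 := by
  ext d
  by_contra hd
  have := degree_eq_and_weight_eq hq hw hd
  omega

lemma exists_eq_smul_of_weight {i j : ℕ} {q : MvPolynomial (Fin 2) ℂ}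
    (hq : q ∈ homogeneousSubmodule (Fin 2) ℂ (i + j))
    (hw : weightOp q = ((i - j : ℤ) : ℂ) • q) :
    ∃ x : ℂ, q = x • (X 0 ^ i * X 1 ^ j) := by
  refine ⟨coeff (Finsupp.single 0 i + Finsupp.single 1 j) q, ?_⟩
  ext d
  rw [X_pow_mul_X_pow_eq, coeff_smul, coeff_monomial]
  split_ifs with h
  · simp [h]
  · rw [smul_zero]
    by_contra hd
    have := degree_eq_and_weight_eq hq hw hd
    refine h (Finsupp.ext fun k ↦ ?_)
    fin_cases k <;> simp <;> omega

lemma X_pow_mul_mem (i j : ℕ) :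
    X 0 ^ i * X 1 ^ j ∈ homogeneousSubmodule (Fin 2) ℂ (i + j) :=
  (isHomogeneous_X_pow 0 i).mul (isHomogeneous_X_pow 1 j)

/-- An operator on degree `n` polynomials which is a highest weight vector of weight two is a
multiple of the raising operator. -/
lemma exists_eq_smul_raiseOp {n : ℕ} (G : Module.End ℂ (MvPolynomial (Fin 2) ℂ))
    (hG : ∀ p ∈ homogeneousSubmodule (Fin 2) ℂ n, G p ∈ homogeneousSubmodule (Fin 2) ℂ n)
    (hraise : ∀ p ∈ homogeneousSubmodule (Fin 2) ℂ n, raiseOp (G p) = G (raiseOp p))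
    (hweight : ∀ p ∈ homogeneousSubmodule (Fin 2) ℂ n,
      weightOp (G p) - G (weightOp p) = (2 : ℂ) • G p) :
    ∃ c : ℂ, ∀ p ∈ homogeneousSubmodule (Fin 2) ℂ n, G p = c • raiseOp p := by
  have hw (i j : ℕ) (hij : i + j = n) : weightOp (G (X 0 ^ i * X 1 ^ j)) =
      ((i - j + 2 : ℤ) : ℂ) • G (X 0 ^ i * X 1 ^ j) := by
    have h := hweight _ (hij ▸ X_pow_mul_mem i j)
    rw [weightOp_X_pow_mul, map_smul, sub_eq_iff_eq_add] at h
    rw [h]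
    push_cast
    module
  have hstep (i j : ℕ) (hij : i + (j + 1) = n) :
      ∃ x : ℂ, G (X 0 ^ i * X 1 ^ (j + 1)) = x • (X 0 ^ (i + 1) * X 1 ^ j) := by
    apply exists_eq_smul_of_weight
    · rw [show i + 1 + j = n by omega]
      exact hG _ (hij ▸ X_pow_mul_mem i (j + 1))
    · rw [hw i (j + 1) hij]
      congr 2
      push_cast
      ring
  obtain ⟨c, hc⟩ : ∃ c : ℂ, ∀ j i : ℕ, i + j = n →
      G (X 0 ^ i * X 1 ^ j) = c • raiseOp (X 0 ^ i * X 1 ^ j) := by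
    have hzero : G (X 0 ^ n * X 1 ^ 0) = 0 :=
      eq_zero_of_weight_gt (hG _ (X_pow_mul_mem n 0)) (hw n 0 rfl) (by push_cast; omega)
    obtain ⟨c, hc⟩ : ∃ c : ℂ, ∀ i, i + 1 = n → G (X 0 ^ i * X 1 ^ 1) =
        c • raiseOp (X 0 ^ i * X 1 ^ 1) := by
      rcases n with _ | n
      · exact ⟨0, by simp⟩
      · obtain ⟨x, hx⟩ := hstep n 0 rfl
        refine ⟨x, fun i hi ↦ ?_⟩
        obtain rfl : i = n := by omega
        rw [raiseOp_X_pow_mul_succ, hx]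
        simp
    refine ⟨c, fun j ↦ ?_⟩
    induction j with
    | zero =>
      rintro i rfl
      rw [add_zero] at hzero
      rw [hzero, pow_zero, mul_one, raiseOp_X_pow, smul_zero]
    | succ j ih =>
      rcases j with _ | j
      · exact hc
      intro i hij
      obtain ⟨x, hx⟩ := hstep i (j + 1) hij
      have h := hraise _ (hij ▸ X_pow_mul_mem i (j + 1 + 1))
      rw [hx, map_smul, raiseOp_X_pow_mul_succ, raiseOp_X_pow_mul_succ, map_smul,
        ih (i + 1) (by omega), raiseOp_X_pow_mul_succ, smul_smul, smul_smul, smul_smul] at h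
      have hne : (X 0 ^ (i + 1 + 1) * X 1 ^ j : MvPolynomial (Fin 2) ℂ) ≠ 0 := by simp
      have h' := smul_left_injective ℂ hne h
      rw [hx, raiseOp_X_pow_mul_succ, smul_smul]
      congr 1
      have hj : (j : ℂ) + 1 ≠ 0 := by exact_mod_cast j.succ_ne_zero
      apply mul_right_cancel₀ hj
      rw [h']
      ring
  refine ⟨c, fun p hp ↦ ?_⟩
  rw [p.as_sum, map_sum, map_sum, Finset.smul_sum]
  refine Finset.sum_congr rfl fun d hd ↦ ?_
  have hdeg : d 0 + d 1 = n := by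
    rw [← hp (mem_support_iff.1 hd)]
    simp [Finsupp.weight_apply, Finsupp.sum_fintype]
  have hmon : monomial d (coeff d p) = coeff d p • (X 0 ^ d 0 * X 1 ^ d 1) := by
    rw [monomial_eq, Finsupp.prod_fintype _ _ (by simp), Fin.prod_univ_two, smul_eq_C_mul]
  rw [hmon, map_smul, map_smul, hc _ _ hdeg, smul_comm]

lemma raiseOp_eq_Xop (p : MvPolynomial (Fin 2) ℂ) :
    raiseOp p = Xop 0 p + Complex.I • Xop 1 p := by
  simp only [Xop_zero, Xop_one, LinearMap.smul_apply, LinearMap.add_apply, LinearMap.sub_apply]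
  match_scalars <;> grind [Complex.I_sq]

lemma lowerOp_eq_Xop (p : MvPolynomial (Fin 2) ℂ) :
    lowerOp p = Xop 0 p - Complex.I • Xop 1 p := by
  simp only [Xop_zero, Xop_one, LinearMap.smul_apply, LinearMap.add_apply, LinearMap.sub_apply]
  match_scalars <;> grind [Complex.I_sq]

lemma weightOp_eq_Xop (p : MvPolynomial (Fin 2) ℂ) : weightOp p = (2 : ℂ) • Xop 2 p := by
  rw [Xop_two, LinearMap.smul_apply]
  module

/-- A triple of operators on degree `n` polynomials which transforms as a vector under `su(2)` is
proportional to the triple of generators. -/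
lemma exists_eq_smul_Xop {n : ℕ} (G : Fin 3 → Module.End ℂ (MvPolynomial (Fin 2) ℂ))
    (hG : ∀ a, ∀ p ∈ homogeneousSubmodule (Fin 2) ℂ n, G a p ∈ homogeneousSubmodule (Fin 2) ℂ n)
    (hcomm : ∀ a b, ∀ p ∈ homogeneousSubmodule (Fin 2) ℂ n,
      Xop a (G b p) - G b (Xop a p) = Complex.I • ∑ c, eps a b c • G c p) :
    ∃ f : ℂ, ∀ a, ∀ p ∈ homogeneousSubmodule (Fin 2) ℂ n, G a p = f • Xop a p := by
  have hI := Complex.I_sq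
  have h00 := hcomm 0 0
  have h01 := hcomm 0 1
  have h02 := hcomm 0 2
  have h10 := hcomm 1 0
  have h11 := hcomm 1 1
  have h12 := hcomm 1 2
  have h20 := hcomm 2 0
  have h21 := hcomm 2 1
  norm_num [Fin.sum_univ_three, eps, -mem_homogeneousSubmodule] at h00 h01 h02 h10 h11 h12 h20 h21
  obtain ⟨f, hf⟩ := exists_eq_smul_raiseOp (n := n) (G 0 + Complex.I • G 1)
    (fun p hp ↦ add_mem (hG 0 p hp) (Submodule.smul_mem _ _ (hG 1 p hp)))
    (fun p hp ↦ by
      simp only [raiseOp_eq_Xop, LinearMap.add_apply, LinearMap.smul_apply, map_add, map_smul]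
      linear_combination (norm := module) h00 p hp + Complex.I • h01 p hp + Complex.I • h10 p hp
        + (Complex.I * Complex.I) • h11 p hp)
    (fun p hp ↦ by
      simp only [weightOp_eq_Xop, LinearMap.add_apply, LinearMap.smul_apply, map_add, map_smul]
      linear_combination (norm := module) (2 : ℂ) • h20 p hp + (2 * Complex.I) • h21 p hp
        - hI • ((2 : ℂ) • G 0 p))
  have hf2 (p) (hp : p ∈ homogeneousSubmodule (Fin 2) ℂ n) : G 2 p = f • Xop 2 p := by
    have hc : lowerOp ((G 0 + Complex.I • G 1) p) - (G 0 + Complex.I • G 1) (lowerOp p) =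
        (-2 : ℂ) • G 2 p := by
      simp only [lowerOp_eq_Xop, LinearMap.add_apply, LinearMap.smul_apply, map_add, map_sub,
        map_smul]
      linear_combination (norm := module) h00 p hp + Complex.I • h01 p hp
        - Complex.I • h10 p hp - (Complex.I * Complex.I) • h11 p hp
        + hI • ((2 : ℂ) • G 2 p)
    have hl := lowerOp_raiseOp_sub p
    rw [hf p hp, hf (lowerOp p) (X_mul_pderiv_mem 1 0 hp), map_smul] at hc
    rw [weightOp_eq_Xop] at hl
    linear_combination (norm := module) (1 / 2 : ℂ) • hc - (f / 2) • hl
  have hf3 (p) (hp : p ∈ homogeneousSubmodule (Fin 2) ℂ n) :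
      G 0 p - Complex.I • G 1 p = f • lowerOp p := by
    have hc : lowerOp (G 2 p) - G 2 (lowerOp p) = G 0 p - Complex.I • G 1 p := by
      simp only [lowerOp_eq_Xop, map_sub, map_smul]
      linear_combination (norm := module) h02 p hp - Complex.I • h12 p hp
        - hI • G 0 p
    have hl := lowerOp_weightOp_sub p
    rw [hf2 p hp, hf2 (lowerOp p) (X_mul_pderiv_mem 1 0 hp), map_smul] at hc
    rw [weightOp_eq_Xop, weightOp_eq_Xop, map_smul] at hl
    linear_combination (norm := module) (f / 2) • hl - hc
  refine ⟨f, fun a p hp ↦ ?_⟩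
  have h1 := hf p hp
  have h2 := hf3 p hp
  rw [raiseOp_eq_Xop] at h1
  rw [lowerOp_eq_Xop] at h2
  simp only [LinearMap.add_apply, LinearMap.smul_apply] at h1
  fin_cases a
  · dsimp
    linear_combination (norm := module) (1/2:ℂ) • h1 + (1/2:ℂ) • h2
  · dsimp
    linear_combination (norm := module) (-Complex.I/2) • h1 + (Complex.I/2) • h2
      + hI • (G 1 p - f • Xop 1 p)
  · exact hf2 p hp

/-- **Lemma 4.2** (infinitesimal form): if `F : {1,2,3}² → End(P_n)` is antisymmetric and
equivariant, i.e. `[X_a, F(b,c)] = i·Σ_d (ε_{abd} F(d,c) + ε_{acd} F(b,d))` on the space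
`P_n` of homogeneous polynomials of degree `n`, then there is a scalar `f ∈ ℂ` with
`F(a,b) = f · Σ_c ε_{abc} X_c`.  (All operators are constrained only on `P_n`, encoded by
evaluation on homogeneous polynomials of degree `n`.) -/
theorem invariant_two_form_unique (n : ℕ)
    (F : Fin 3 → Fin 3 → Module.End ℂ (MvPolynomial (Fin 2) ℂ))
    (hpres : ∀ a b : Fin 3, ∀ p ∈ homogeneousSubmodule (Fin 2) ℂ n,
      F a b p ∈ homogeneousSubmodule (Fin 2) ℂ n)
    (hanti : ∀ a b : Fin 3, ∀ p ∈ homogeneousSubmodule (Fin 2) ℂ n,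
      F a b p = - F b a p)
    (hequiv : ∀ a b c : Fin 3, ∀ p ∈ homogeneousSubmodule (Fin 2) ℂ n,
      (Xop a * F b c - F b c * Xop a) p
        = Complex.I • (∑ d : Fin 3, (eps a b d • F d c + eps a c d • F b d)) p) :
    ∃ f : ℂ, ∀ a b : Fin 3, ∀ p ∈ homogeneousSubmodule (Fin 2) ℂ n,
      F a b p = f • (∑ c : Fin 3, eps a b c • Xop c) p := by
  obtain ⟨f, hf⟩ := exists_eq_smul_Xop (n := n) ![F 1 2, F 2 0, F 0 1]
    (fun a ↦ by fin_cases a <;> exact hpres _ _)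
    (fun a b p hp ↦ by
      have h (b c) := hequiv a b c p hp
      have hd (a) : F a a p = 0 := self_eq_neg.1 (hanti a a p hp)
      have h10 := hanti 1 0 p hp
      have h21 := hanti 2 1 p hp
      have h02 := hanti 0 2 p hp
      fin_cases b
      · have := h 1 2
        fin_cases a <;> simp [Fin.sum_univ_three, eps, hd, h10, h02] at this ⊢ <;>
          linear_combination (norm := module) this
      · have := h 2 0
        fin_cases a <;> simp [Fin.sum_univ_three, eps, hd, h10, h21] at this ⊢ <;>
          linear_combination (norm := module) this
      · have := h 0 1
        fin_cases a <;> simp [Fin.sum_univ_three, eps, hd, h21, h02] at this ⊢ <;>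
          linear_combination (norm := module) this)
  refine ⟨f, fun a b p hp ↦ ?_⟩
  have h0 := hf 0 p hp
  have h1 := hf 1 p hp
  have h2 := hf 2 p hp
  have hd (a) : F a a p = 0 := self_eq_neg.1 (hanti a a p hp)
  have h10 := hanti 1 0 p hp
  have h21 := hanti 2 1 p hp
  have h02 := hanti 0 2 p hp
  simp at h0 h1 h2
  fin_cases a <;> fin_cases b <;> dsimp only [Fin.reduceFinMk, Fin.zero_eta, Fin.mk_one] <;>
    norm_num [Fin.sum_univ_three, eps, hd, h10, h21, h02, h0, h1, h2]
end
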